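/- (Exterior bound on the normal component, planar form of (4.22).) Under the hypotheses of the two-dimensional Korn–Poincaré estimate (A_θ, A_z ∈ C², u ∈ C² with u = 0 on ∂E, uniform bounds 0 < a ≤ A_θ, A_z ≤ A, |∇A_θ| + |∇A_z| ≤ B, Codazzi–Gauss identity, κ_θ, κ_z ≥ 0 with (1/c)√(κ_θκ_z) ≤ κ_θ, κ_z ≤ c√(κ_θκ_z), ρ = κ_z/κ_θ extending to C¹ with ρ₀ ≤ ρ ≤ ρ₁, |∇ρ| ≤ c₂, and L ≤ C₀), suppose in addition that D ⊂ E is a measurable subset and μ > 0 is such that √(κ_θ κ_z) ≥ μ on E \ D. Then there exists a constant C > 0, depending only on a, A, B, c, ρ₀, ρ₁, c₂, such that ‖u_t‖_{L²(E \ D)} ≤ (C/μ) ‖|F^sym|‖_{L²(E)}. In particular, if √(κ_θκ_z) ≥ C₁ h^{2α} outside the disc of radius h^α centered at the flat point, then ‖u_t‖_{L²(E \ D)} ≤ C h^{−2α} ‖|F^sym|‖_{L²(E)}. -/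

import Mathlib

open MeasureTheory Set Real

noncomputable section

/-- Partial derivative in `θ` of a scalar function on the parameter plane `(θ, z)`. -/
def dTh (f : ℝ × ℝ → ℝ) (p : ℝ × ℝ) : ℝ := fderiv ℝ f p (1, 0)

/-- Partial derivative in `z` of a scalar function on the parameter plane `(θ, z)`. -/
def dZ (f : ℝ × ℝ → ℝ) (p : ℝ × ℝ) : ℝ := fderiv ℝ f p (0, 1)

/-- The two-dimensional data: the functions `z1, z2` determining the parameter domain `E`,
the metric coefficients `Ath = A_θ`, `Az = A_z`, the principal curvatures `kth = κ_θ`,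
`kz = κ_z`, and the components `ut = u_t`, `uth = u_θ`, `uz = u_z` of a displacement. -/
structure Setup2D where
  z1 : ℝ → ℝ
  z2 : ℝ → ℝ
  Ath : ℝ × ℝ → ℝ
  Az : ℝ × ℝ → ℝ
  kth : ℝ × ℝ → ℝ
  kz : ℝ × ℝ → ℝ
  ut : ℝ × ℝ → ℝ
  uth : ℝ × ℝ → ℝ
  uz : ℝ × ℝ → ℝ

namespace Setup2D

/-- The parameter domain `E = {(θ,z) : θ ∈ (0,1), z ∈ (z1 θ, z2 θ)}`. -/
def E (S : Setup2D) : Set (ℝ × ℝ) :=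
  {p | p.1 ∈ Ioo (0 : ℝ) 1 ∧ p.2 ∈ Ioo (S.z1 p.1) (S.z2 p.1)}

/-- The entry `F₂₂` of the simplified gradient. -/
def F22 (S : Setup2D) (p : ℝ × ℝ) : ℝ :=
  (S.Az p * dTh S.uth p + S.Az p * S.Ath p * S.kth p * S.ut p + dZ S.Ath p * S.uz p) /
    (S.Az p * S.Ath p)

/-- The entry `F₂₃` of the simplified gradient. -/
def F23 (S : Setup2D) (p : ℝ × ℝ) : ℝ :=
  (S.Ath p * dZ S.uth p - dTh S.Az p * S.uz p) / (S.Az p * S.Ath p)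

/-- The entry `F₃₂` of the simplified gradient. -/
def F32 (S : Setup2D) (p : ℝ × ℝ) : ℝ :=
  (S.Az p * dTh S.uz p - dZ S.Ath p * S.uth p) / (S.Az p * S.Ath p)

/-- The entry `F₃₃` of the simplified gradient. -/
def F33 (S : Setup2D) (p : ℝ × ℝ) : ℝ :=
  (S.Ath p * dZ S.uz p + S.Az p * S.Ath p * S.kz p * S.ut p + dTh S.Az p * S.uth p) /
    (S.Az p * S.Ath p)

/-- `F₂₃^sym = (F₂₃ + F₃₂)/2`. -/
def F23sym (S : Setup2D) (p : ℝ × ℝ) : ℝ := (S.F23 p + S.F32 p) / 2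

/-- `|F^sym|² = F₂₂² + 2 (F₂₃^sym)² + F₃₃²`. -/
def FsymSq (S : Setup2D) (p : ℝ × ℝ) : ℝ := S.F22 p ^ 2 + 2 * S.F23sym p ^ 2 + S.F33 p ^ 2

/-- The weighted inner product `(f, g)_E = ∫_E A_θ A_z f g dθ dz`. -/
def ip (S : Setup2D) (f g : ℝ × ℝ → ℝ) : ℝ := ∫ p in S.E, S.Ath p * S.Az p * f p * g p

/-- The weighted squared norm `‖f‖²_E`. -/
def nsq (S : Setup2D) (f : ℝ × ℝ → ℝ) : ℝ := S.ip f f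

/-- The weighted squared norm `‖|F^sym|‖²_E` of the simplified symmetrized gradient. -/
def nF (S : Setup2D) : ℝ := ∫ p in S.E, S.Ath p * S.Az p * S.FsymSq p

/-- The standing context: the form of the domain, the regularity `A_θ, A_z, κ_θ, κ_z ∈ C¹`,
positivity of `A_θ, A_z` on the closure of `E`, and `u ∈ C¹`. -/
def Base (S : Setup2D) : Prop :=
  (∀ θ ∈ Icc (0 : ℝ) 1, 0 ≤ S.z1 θ ∧ S.z1 θ < S.z2 θ ∧ S.z2 θ ≤ 1) ∧
  ContDiff ℝ 1 S.Ath ∧ ContDiff ℝ 1 S.Az ∧ ContDiff ℝ 1 S.kth ∧ ContDiff ℝ 1 S.kz ∧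
  (∀ p ∈ closure S.E, 0 < S.Ath p ∧ 0 < S.Az p) ∧
  ContDiff ℝ 1 S.ut ∧ ContDiff ℝ 1 S.uth ∧ ContDiff ℝ 1 S.uz

/-- The boundary condition `u = 0` on `∂E`. -/
def BZero (S : Setup2D) : Prop := ∀ p ∈ frontier S.E, S.ut p = 0 ∧ S.uth p = 0 ∧ S.uz p = 0

/-- The additional `C²` regularity of `A_θ, A_z` and `u`. -/
def Csq (S : Setup2D) : Prop :=
  ContDiff ℝ 2 S.Ath ∧ ContDiff ℝ 2 S.Az ∧
  ContDiff ℝ 2 S.ut ∧ ContDiff ℝ 2 S.uth ∧ ContDiff ℝ 2 S.uz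

/-- The Codazzi–Gauss identity `∂_z(A_{θ,z}/A_z) + ∂_θ(A_{z,θ}/A_θ) = -A_z A_θ κ_z κ_θ`. -/
def CodazziGauss (S : Setup2D) : Prop :=
  ∀ p ∈ S.E,
    dZ (fun q => dZ S.Ath q / S.Az q) p + dTh (fun q => dTh S.Az q / S.Ath q) p =
      -(S.Az p * S.Ath p * S.kz p * S.kth p)

/-- The uniform bounds `a ≤ A_θ, A_z ≤ A` and `|∇A_θ| + |∇A_z| ≤ B` on the closure of `E`. -/
def Bounds (S : Setup2D) (a A B : ℝ) : Prop :=
  ∀ p ∈ closure S.E, a ≤ S.Ath p ∧ S.Ath p ≤ A ∧ a ≤ S.Az p ∧ S.Az p ≤ A ∧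
    ‖fderiv ℝ S.Ath p‖ + ‖fderiv ℝ S.Az p‖ ≤ B

/-- `ρ` satisfies `κ_z = ρ κ_θ` with `ρ₀ ≤ ρ ≤ ρ₁` and `|∇ρ| ≤ c2`. -/
def RhoHyp (S : Setup2D) (ρ : ℝ × ℝ → ℝ) (ρ0 ρ1 c2 : ℝ) : Prop :=
  ContDiff ℝ 1 ρ ∧ (∀ p ∈ S.E, S.kz p = ρ p * S.kth p) ∧
  (∀ p ∈ closure S.E, ρ0 ≤ ρ p ∧ ρ p ≤ ρ1 ∧ ‖fderiv ℝ ρ p‖ ≤ c2)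

/-- Nonnegativity of the curvatures and the comparability condition
`(1/c)√(κ_θ κ_z) ≤ κ_θ, κ_z ≤ c √(κ_θ κ_z)` on `E`. -/
def Comparable (S : Setup2D) (c : ℝ) : Prop :=
  ∀ p ∈ S.E, 0 ≤ S.kth p ∧ 0 ≤ S.kz p ∧
    c⁻¹ * Real.sqrt (S.kth p * S.kz p) ≤ S.kth p ∧
    S.kth p ≤ c * Real.sqrt (S.kth p * S.kz p) ∧
    c⁻¹ * Real.sqrt (S.kth p * S.kz p) ≤ S.kz p ∧
    S.kz p ≤ c * Real.sqrt (S.kth p * S.kz p)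

end Setup2D

open Filter Topology

/-- The zeros of a function at which its derivative does not vanish are isolated, hence countably
many. -/
lemma countable_zeros_hasDerivAt_ne_zero {w w' : ℝ → ℝ} (hw : ∀ x, HasDerivAt w (w' x) x) :
    {x | w x = 0 ∧ w' x ≠ 0}.Countable := by
  refine (HereditarilyLindelofSpace.isLindelof _).countable_of_isDiscrete ?_
  rw [isDiscrete_iff_nhdsNE]
  rintro x ⟨-, hx'⟩
  rw [inf_principal_eq_bot]
  filter_upwards [(hw x).eventually_ne (c := 0) hx'] with y hy hy'
  exact hy hy'.1

lemma hasDerivAt_indicator_of_zero_frontier {V : Set ℝ} (hV : IsOpen V) {w w' : ℝ → ℝ}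
    (hw : ∀ x, HasDerivAt w (w' x) x) (h0 : ∀ x ∈ frontier V, w x = 0) {x : ℝ}
    (hx : ¬ (w x = 0 ∧ w' x ≠ 0)) :
    HasDerivAt (V.indicator w) (V.indicator w' x) x := by
  by_cases hxV : x ∈ V
  · rw [indicator_of_mem hxV]
    refine (hw x).congr_of_eventuallyEq ?_
    filter_upwards [hV.mem_nhds hxV] with y hy using indicator_of_mem hy w
  rw [indicator_of_notMem hxV]
  by_cases hxc : x ∈ closure V
  · have hwx : w x = 0 := h0 x (by rw [hV.frontier_eq]; exact ⟨hxc, hxV⟩)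
    have hw'x : w' x = 0 := by
      by_contra h
      exact hx ⟨hwx, h⟩
    have h := hw x
    rw [hw'x, hasDerivAt_iff_isLittleO] at h
    rw [hasDerivAt_iff_isLittleO]
    refine Asymptotics.IsBigO.trans_isLittleO
      (Asymptotics.IsBigO.of_bound' (Eventually.of_forall fun y => ?_)) h
    simp only [hwx, indicator_of_notMem hxV, smul_zero, sub_zero]
    exact norm_indicator_le_norm_self w y
  · refine (hasDerivAt_const x (0 : ℝ)).congr_of_eventuallyEq ?_
    filter_upwards [isClosed_closure.isOpen_compl.mem_nhds hxc] with y hy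
    exact indicator_of_notMem (fun h => hy (subset_closure h)) w

/-- The fundamental theorem of calculus on a bounded open subset of the line, for a function
vanishing on the frontier. -/
lemma setIntegral_deriv_eq_zero {V : Set ℝ} (hV : IsOpen V) (hb : Bornology.IsBounded V)
    {w w' : ℝ → ℝ} (hw : ∀ x, HasDerivAt w (w' x) x) (hw' : Continuous w')
    (h0 : ∀ x ∈ frontier V, w x = 0) : ∫ x in V, w' x = 0 := by
  obtain ⟨R, hR0, hR⟩ := hb.subset_ball_lt 0 0
  rw [Real.ball_eq_Ioo, zero_sub, zero_add] at hR
  have hcont : Continuous w := continuous_iff_continuousAt.2 fun x => (hw x).continuousAt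
  have key := integral_eq_of_hasDerivAt_off_countable
    (V.indicator w) (V.indicator w') (a := -R) (b := R) (countable_zeros_hasDerivAt_ne_zero hw)
    (continuous_indicator h0 hcont.continuousOn).continuousOn
    (fun x hx => hasDerivAt_indicator_of_zero_frontier hV hw h0 hx.2)
    (by
      rw [intervalIntegrable_iff]
      exact (intervalIntegrable_iff.1 (hw'.intervalIntegrable (-R) R)).indicator
        hV.measurableSet)
  rw [indicator_of_notMem fun h => lt_irrefl R (hR h).2,
    indicator_of_notMem fun h => lt_irrefl (-R) (hR h).1, sub_zero,
    intervalIntegral.integral_of_le (by linarith), setIntegral_eq_integral_of_forall_compl_eq_zero,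
    integral_indicator hV.measurableSet] at key
  · exact key
  · intro x hx
    exact indicator_of_notMem (fun h => hx (Ioo_subset_Ioc_self (hR h))) w'

section PlanarSlices

variable {U : Set (ℝ × ℝ)}

lemma setIntegral_eq_integral_slice (hU : IsOpen U) {F : ℝ × ℝ → ℝ} (hF : IntegrableOn F U) :
    ∫ p in U, F p = ∫ x, ∫ y in {y | (x, y) ∈ U}, F (x, y) := by
  rw [← integral_indicator hU.measurableSet, Measure.volume_eq_prod, integral_prod]
  · refine integral_congr_ae (Eventually.of_forall fun x => ?_)
    have hm : MeasurableSet {y | (x, y) ∈ U} := hU.measurableSet.preimage measurable_prodMk_left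
    simp only [← integral_indicator hm]
    rfl
  · rw [← Measure.volume_eq_prod]
    exact hF.integrable_indicator hU.measurableSet

lemma setIntegral_eq_integral_slice_symm (hU : IsOpen U) {F : ℝ × ℝ → ℝ}
    (hF : IntegrableOn F U) :
    ∫ p in U, F p = ∫ y, ∫ x in {x | (x, y) ∈ U}, F (x, y) := by
  rw [← integral_indicator hU.measurableSet, Measure.volume_eq_prod, integral_prod_symm]
  · refine integral_congr_ae (Eventually.of_forall fun y => ?_)
    have hm : MeasurableSet {x | (x, y) ∈ U} := hU.measurableSet.preimage measurable_prodMk_right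
    simp only [← integral_indicator hm]
    rfl
  · rw [← Measure.volume_eq_prod]
    exact hF.integrable_indicator hU.measurableSet

lemma integrable_integral_slice (hU : IsOpen U) {F : ℝ × ℝ → ℝ} (hF : IntegrableOn F U) :
    Integrable fun x => ∫ y in {y | (x, y) ∈ U}, F (x, y) := by
  have h := hF.integrable_indicator hU.measurableSet
  rw [Measure.volume_eq_prod] at h
  refine h.integral_prod_left.congr (Eventually.of_forall fun x => ?_)
  have hm : MeasurableSet {y | (x, y) ∈ U} := hU.measurableSet.preimage measurable_prodMk_left
  simp only [← integral_indicator hm]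
  rfl

lemma ContinuousOn.integrableOn_of_isBounded (hb : Bornology.IsBounded U) {F : ℝ × ℝ → ℝ}
    (hF : ContinuousOn F (closure U)) : IntegrableOn F U :=
  (hF.integrableOn_compact hb.isCompact_closure).mono_set subset_closure

lemma isBounded_slice_snd (hb : Bornology.IsBounded U) (x : ℝ) :
    Bornology.IsBounded {y | (x, y) ∈ U} :=
  hb.image_snd.subset fun y hy => ⟨(x, y), hy, rfl⟩

lemma isBounded_slice_fst (hb : Bornology.IsBounded U) (y : ℝ) :
    Bornology.IsBounded {x | (x, y) ∈ U} :=
  hb.image_fst.subset fun x hx => ⟨(x, y), hx, rfl⟩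

end PlanarSlices

section PartialDerivatives

variable {f g : ℝ × ℝ → ℝ}

lemma hasDerivAt_dTh (hf : Differentiable ℝ f) (x y : ℝ) :
    HasDerivAt (fun s => f (s, y)) (dTh f (x, y)) x :=
  (hf (x, y)).hasFDerivAt.comp_hasDerivAt x ((hasDerivAt_id x).prodMk (hasDerivAt_const x y))

lemma hasDerivAt_dZ (hf : Differentiable ℝ f) (x y : ℝ) :
    HasDerivAt (fun s => f (x, s)) (dZ f (x, y)) y :=
  (hf (x, y)).hasFDerivAt.comp_hasDerivAt y ((hasDerivAt_const y x).prodMk (hasDerivAt_id y))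

lemma contDiff_dTh {m n : WithTop ℕ∞} (hf : ContDiff ℝ n f) (h : m + 1 ≤ n) :
    ContDiff ℝ m (dTh f) :=
  (hf.fderiv_right h).clm_apply contDiff_const

lemma contDiff_dZ {m n : WithTop ℕ∞} (hf : ContDiff ℝ n f) (h : m + 1 ≤ n) :
    ContDiff ℝ m (dZ f) :=
  (hf.fderiv_right h).clm_apply contDiff_const

lemma continuous_dTh (hf : ContDiff ℝ 1 f) : Continuous (dTh f) :=
  (contDiff_dTh (m := 0) hf (by simp)).continuous

lemma continuous_dZ (hf : ContDiff ℝ 1 f) : Continuous (dZ f) :=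
  (contDiff_dZ (m := 0) hf (by simp)).continuous

lemma dTh_mul {p : ℝ × ℝ} (hf : DifferentiableAt ℝ f p) (hg : DifferentiableAt ℝ g p) :
    dTh (fun q => f q * g q) p = f p * dTh g p + g p * dTh f p := by
  simp [dTh, fderiv_fun_mul hf hg]

lemma dZ_mul {p : ℝ × ℝ} (hf : DifferentiableAt ℝ f p) (hg : DifferentiableAt ℝ g p) :
    dZ (fun q => f q * g q) p = f p * dZ g p + g p * dZ f p := by
  simp [dZ, fderiv_fun_mul hf hg]

lemma dTh_dZ_comm (hf : ContDiff ℝ 2 f) (p : ℝ × ℝ) : dTh (dZ f) p = dZ (dTh f) p := by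
  have hd : DifferentiableAt ℝ (fderiv ℝ f) p :=
    (hf.fderiv_right (m := 1) (by norm_num)).differentiable (by norm_num) p
  have hs := hf.contDiffAt.isSymmSndFDerivAt (x := p) (by simp)
  have h1 : dTh (dZ f) p = fderiv ℝ (fderiv ℝ f) p (1, 0) (0, 1) := by
    unfold dTh dZ
    rw [fderiv_clm_apply hd (differentiableAt_const _)]
    simp
  have h2 : dZ (dTh f) p = fderiv ℝ (fderiv ℝ f) p (0, 1) (1, 0) := by
    unfold dTh dZ
    rw [fderiv_clm_apply hd (differentiableAt_const _)]
    simp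
  rw [h1, h2]
  exact hs _ _

lemma abs_dTh_le (f : ℝ × ℝ → ℝ) (p : ℝ × ℝ) : |dTh f p| ≤ ‖fderiv ℝ f p‖ := by
  have h := (fderiv ℝ f p).le_opNorm (1, 0)
  simpa [dTh, Prod.norm_def] using h

lemma abs_dZ_le (f : ℝ × ℝ → ℝ) (p : ℝ × ℝ) : |dZ f p| ≤ ‖fderiv ℝ f p‖ := by
  have h := (fderiv ℝ f p).le_opNorm (0, 1)
  simpa [dZ, Prod.norm_def] using h

end PartialDerivatives

section VanishingOnFrontier

variable {U : Set (ℝ × ℝ)} {w f g m : ℝ × ℝ → ℝ}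

lemma setIntegral_dTh_eq_zero (hU : IsOpen U) (hb : Bornology.IsBounded U)
    (hw : ContDiff ℝ 1 w) (h0 : ∀ p ∈ frontier U, w p = 0) : ∫ p in U, dTh w p = 0 := by
  have hc := continuous_dTh hw
  rw [setIntegral_eq_integral_slice_symm hU (hc.continuousOn.integrableOn_of_isBounded hb)]
  refine integral_eq_zero_of_ae (Eventually.of_forall fun y => ?_)
  have hy : Continuous fun x : ℝ => (x, y) := by fun_prop
  exact setIntegral_deriv_eq_zero (hU.preimage hy) (isBounded_slice_fst hb y)
    (fun x => hasDerivAt_dTh (hw.differentiable (by norm_num)) x y) (hc.comp hy)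
    fun x hx => h0 _ (hy.frontier_preimage_subset U hx)

lemma setIntegral_dZ_eq_zero (hU : IsOpen U) (hb : Bornology.IsBounded U)
    (hw : ContDiff ℝ 1 w) (h0 : ∀ p ∈ frontier U, w p = 0) : ∫ p in U, dZ w p = 0 := by
  have hc := continuous_dZ hw
  rw [setIntegral_eq_integral_slice hU (hc.continuousOn.integrableOn_of_isBounded hb)]
  refine integral_eq_zero_of_ae (Eventually.of_forall fun x => ?_)
  have hx : Continuous fun y : ℝ => (x, y) := by fun_prop
  exact setIntegral_deriv_eq_zero (hU.preimage hx) (isBounded_slice_snd hb x)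
    (fun y => hasDerivAt_dZ (hw.differentiable (by norm_num)) x y) (hc.comp hx)
    fun y hy => h0 _ (hx.frontier_preimage_subset U hy)

/-- The one-dimensional Poincaré inequality on a bounded open set within distance `l` of `z`. -/
lemma setIntegral_sq_le_of_zero_frontier {V : Set ℝ} (hV : IsOpen V)
    (hb : Bornology.IsBounded V) {f f' : ℝ → ℝ} (hf : ∀ y, HasDerivAt f (f' y) y)
    (hf' : Continuous f') (h0 : ∀ y ∈ frontier V, f y = 0) {z l : ℝ}
    (hz : ∀ y ∈ V, |y - z| ≤ l) :
    ∫ y in V, f y ^ 2 ≤ 4 * l ^ 2 * ∫ y in V, f' y ^ 2 := by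
  have hc : Continuous f := continuous_iff_continuousAt.2 fun x => (hf x).continuousAt
  have hint : ∀ {F : ℝ → ℝ}, Continuous F → IntegrableOn F V := fun hF =>
    (hF.continuousOn.integrableOn_compact hb.isCompact_closure).mono_set subset_closure
  have hzero := setIntegral_deriv_eq_zero hV hb
    (w := fun y => (y - z) * f y ^ 2) (w' := fun y => f y ^ 2 + (y - z) * (2 * f y * f' y))
    (fun y => by
      have h := ((hasDerivAt_id' y).sub_const z).mul ((hf y).pow 2)
      exact h.congr_deriv (by simp))
    (by fun_prop) (fun y hy => by simp [h0 y hy])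
  calc ∫ y in V, f y ^ 2
      ≤ ∫ y in V, (2 * (f y ^ 2 + (y - z) * (2 * f y * f' y)) + 4 * l ^ 2 * f' y ^ 2) := by
        refine setIntegral_mono_on (hint (by fun_prop)) (hint (by fun_prop)) hV.measurableSet
          fun y hy => ?_
        have h1 : (y - z) ^ 2 * f' y ^ 2 ≤ l ^ 2 * f' y ^ 2 :=
          mul_le_mul_of_nonneg_right (sq_le_sq' (abs_le.1 (hz y hy)).1 (abs_le.1 (hz y hy)).2)
            (sq_nonneg _)
        nlinarith [sq_nonneg (f y + 2 * (y - z) * f' y)]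
    _ = 4 * l ^ 2 * ∫ y in V, f' y ^ 2 := by
        rw [integral_add (hint (by fun_prop)) (hint (by fun_prop)), integral_const_mul, hzero,
          integral_const_mul]
        ring

/-- The Poincaré inequality in the `z` direction, on a domain of width `l`. -/
lemma setIntegral_sq_le_dZ_sq (hU : IsOpen U) (hb : Bornology.IsBounded U)
    (hf : ContDiff ℝ 1 f) (h0 : ∀ p ∈ frontier U, f p = 0) {z : ℝ → ℝ} {l : ℝ}
    (hz : ∀ p ∈ U, |p.2 - z p.1| ≤ l) :
    ∫ p in U, f p ^ 2 ≤ 4 * l ^ 2 * ∫ p in U, dZ f p ^ 2 := by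
  have hc := continuous_dZ hf
  have hi1 : IntegrableOn (fun p => f p ^ 2) U :=
    (hf.continuous.pow 2).continuousOn.integrableOn_of_isBounded hb
  have hi2 : IntegrableOn (fun p => dZ f p ^ 2) U :=
    (hc.pow 2).continuousOn.integrableOn_of_isBounded hb
  rw [setIntegral_eq_integral_slice hU hi1, setIntegral_eq_integral_slice hU hi2,
    ← integral_const_mul]
  refine integral_mono (integrable_integral_slice hU hi1)
    ((integrable_integral_slice hU hi2).const_mul _) fun x => ?_
  have hx : Continuous fun y : ℝ => (x, y) := by fun_prop
  exact setIntegral_sq_le_of_zero_frontier (z := z x) (hU.preimage hx) (isBounded_slice_snd hb x)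
    (fun y => hasDerivAt_dZ (hf.differentiable (by norm_num)) x y) (hc.comp hx)
    (fun y hy => h0 _ (hx.frontier_preimage_subset U hy)) fun y hy => hz (x, y) hy

/-- The Jacobian determinant with a weight `m` is a divergence up to first-order terms in `m`. -/
lemma setIntegral_weighted_jacobian (hU : IsOpen U) (hb : Bornology.IsBounded U)
    (hm : ContDiff ℝ 1 m) (hf : ContDiff ℝ 1 f) (hg : ContDiff ℝ 2 g)
    (h0 : ∀ p ∈ frontier U, f p = 0) :
    ∫ p in U, (m p * (dTh f p * dZ g p - dZ f p * dTh g p) +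
      dTh m p * f p * dZ g p - dZ m p * f p * dTh g p) = 0 := by
  have hgx : ContDiff ℝ 1 (dTh g) := contDiff_dTh hg (by norm_num)
  have hgy : ContDiff ℝ 1 (dZ g) := contDiff_dZ hg (by norm_num)
  have hmf : ContDiff ℝ 1 fun p => m p * f p := hm.mul hf
  have h1 := setIntegral_dTh_eq_zero hU hb (hmf.mul hgy) fun p hp => by simp [h0 p hp]
  have h2 := setIntegral_dZ_eq_zero hU hb (hmf.mul hgx) fun p hp => by simp [h0 p hp]
  have h3 := integral_sub
    ((continuous_dTh (hmf.mul hgy)).continuousOn.integrableOn_of_isBounded hb)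
    ((continuous_dZ (hmf.mul hgx)).continuousOn.integrableOn_of_isBounded hb)
  rw [h1, h2, sub_zero] at h3
  rw [← h3]
  refine integral_congr_ae (Eventually.of_forall fun p => ?_)
  have d : ∀ {F : ℝ × ℝ → ℝ}, ContDiff ℝ 1 F → DifferentiableAt ℝ F p :=
    fun hF => hF.differentiable (by norm_num) p
  simp only [dTh_mul (d hmf) (d hgy), dZ_mul (d hmf) (d hgx), dTh_mul (d hm) (d hf),
    dZ_mul (d hm) (d hf), dTh_dZ_comm hg]
  ring

/-- A first-order system whose square controls the full gradient up to a weighted Jacobian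
determinant and zeroth-order terms is coercive on sufficiently thin domains. -/
lemma gradient_estimate_of_jacobian_coercive (hU : IsOpen U) (hb : Bornology.IsBounded U)
    (hm : ContDiff ℝ 1 m) (hf : ContDiff ℝ 1 f) (hg : ContDiff ℝ 2 g)
    (hf0 : ∀ p ∈ frontier U, f p = 0) (hg0 : ∀ p ∈ frontier U, g p = 0)
    {H : ℝ × ℝ → ℝ} (hH : IntegrableOn H U) {k K M l : ℝ} (hk : 0 < k) (hK : 0 ≤ K)
    (hcoer : ∀ p ∈ U, k * (dTh f p ^ 2 + dZ f p ^ 2 + dTh g p ^ 2 + dZ g p ^ 2) ≤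
      K * (H p + f p ^ 2 + g p ^ 2) + 2 * m p * (dTh f p * dZ g p - dZ f p * dTh g p))
    (hmx : ∀ p ∈ U, |dTh m p| ≤ M) (hmy : ∀ p ∈ U, |dZ m p| ≤ M)
    {z : ℝ → ℝ} (hz : ∀ p ∈ U, |p.2 - z p.1| ≤ l)
    (hl : 4 * l ^ 2 * (K + 4 * M ^ 2 / k) ≤ k / 4) :
    ∫ p in U, (dTh f p ^ 2 + dZ f p ^ 2 + dTh g p ^ 2 + dZ g p ^ 2) ≤
        4 * K / k * ∫ p in U, H p ∧
      ∫ p in U, (f p ^ 2 + g p ^ 2) ≤ 4 * l ^ 2 *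
        ∫ p in U, (dTh f p ^ 2 + dZ f p ^ 2 + dTh g p ^ 2 + dZ g p ^ 2) := by
  have hg1 : ContDiff ℝ 1 g := hg.of_le (by norm_num)
  have cf := hf.continuous
  have cg := hg.continuous
  have cm := hm.continuous
  have cfx := continuous_dTh hf
  have cfy := continuous_dZ hf
  have cgx := continuous_dTh hg1
  have cgy := continuous_dZ hg1
  have cmx := continuous_dTh hm
  have cmy := continuous_dZ hm
  have hint : ∀ {F : ℝ × ℝ → ℝ}, Continuous F → IntegrableOn F U := fun hF =>
    hF.continuousOn.integrableOn_of_isBounded hb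
  have hpoinc : ∫ p in U, (f p ^ 2 + g p ^ 2) ≤ 4 * l ^ 2 *
      ∫ p in U, (dTh f p ^ 2 + dZ f p ^ 2 + dTh g p ^ 2 + dZ g p ^ 2) := by
    rw [integral_add (hint (by fun_prop)) (hint (by fun_prop))]
    calc _ ≤ 4 * l ^ 2 * (∫ p in U, dZ f p ^ 2) + 4 * l ^ 2 * ∫ p in U, dZ g p ^ 2 :=
          add_le_add (setIntegral_sq_le_dZ_sq hU hb hf hf0 hz)
            (setIntegral_sq_le_dZ_sq hU hb hg1 hg0 hz)
      _ = 4 * l ^ 2 * ∫ p in U, (dZ f p ^ 2 + dZ g p ^ 2) := by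
          rw [integral_add (hint (by fun_prop)) (hint (by fun_prop))]
          ring
      _ ≤ _ := by
          refine mul_le_mul_of_nonneg_left (integral_mono (hint (by fun_prop))
            (hint (by fun_prop)) fun p => ?_) (by positivity)
          nlinarith [sq_nonneg (dTh f p), sq_nonneg (dTh g p)]
  refine ⟨?_, hpoinc⟩
  have hsum : IntegrableOn (fun p => K * H p + (K + 4 * M ^ 2 / k) * (f p ^ 2 + g p ^ 2)) U :=
    (hH.const_mul K).add (hint (by fun_prop))
  have hint_le : ∫ p in U, k / 2 * (dTh f p ^ 2 + dZ f p ^ 2 + dTh g p ^ 2 + dZ g p ^ 2) ≤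
      ∫ p in U, (K * H p + (K + 4 * M ^ 2 / k) * (f p ^ 2 + g p ^ 2) +
        2 * (m p * (dTh f p * dZ g p - dZ f p * dTh g p) +
          dTh m p * f p * dZ g p - dZ m p * f p * dTh g p)) := by
    refine setIntegral_mono_on (hint (by fun_prop))
      (hsum.add (hint (by fun_prop))) hU.measurableSet
      fun p hp => ?_
    have young : ∀ n v : ℝ, |n| ≤ M → 2 * n * f p * v ≤ k / 2 * v ^ 2 + 2 * M ^ 2 / k * f p ^ 2 := by
      intro n v hn
      have h1 : n ^ 2 * f p ^ 2 ≤ M ^ 2 * f p ^ 2 :=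
        mul_le_mul_of_nonneg_right (sq_le_sq' (abs_le.1 hn).1 (abs_le.1 hn).2) (sq_nonneg _)
      have h2 : k / 2 * v ^ 2 + 2 * M ^ 2 / k * f p ^ 2 - 2 * n * f p * v =
          ((k * v - 2 * n * f p) ^ 2 + 4 * (M ^ 2 * f p ^ 2 - n ^ 2 * f p ^ 2)) / (2 * k) := by
        field_simp
        ring
      have h3 : 0 ≤ ((k * v - 2 * n * f p) ^ 2 + 4 * (M ^ 2 * f p ^ 2 - n ^ 2 * f p ^ 2)) /
          (2 * k) := by
        have := sub_nonneg.2 h1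
        positivity
      linarith
    have y1 := young (-dTh m p) (dZ g p) (by rw [abs_neg]; exact hmx p hp)
    have y2 := young (dZ m p) (dTh g p) (hmy p hp)
    have h4 : 4 * M ^ 2 / k = 2 * (2 * M ^ 2 / k) := by ring
    have h5 : 0 ≤ 2 * M ^ 2 / k * g p ^ 2 := by positivity
    have h6 := hcoer p hp
    have h7 : 0 ≤ k * (dTh f p ^ 2 + dZ f p ^ 2) := by positivity
    rw [h4]
    linarith
  rw [integral_const_mul, integral_add hsum (hint (by fun_prop)),
    integral_add (hH.const_mul K) (hint (by fun_prop)), integral_const_mul, integral_const_mul,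
    integral_const_mul, setIntegral_weighted_jacobian hU hb hm hf hg hf0,
    mul_zero, add_zero] at hint_le
  have hG0 : 0 ≤ ∫ p in U, (dTh f p ^ 2 + dZ f p ^ 2 + dTh g p ^ 2 + dZ g p ^ 2) :=
    integral_nonneg fun p => by positivity
  have h8 := mul_le_mul_of_nonneg_left hpoinc (show 0 ≤ K + 4 * M ^ 2 / k by positivity)
  have h9 := mul_le_mul_of_nonneg_right hl hG0
  rw [div_mul_eq_mul_div, le_div_iff₀ hk]
  linarith

end VanishingOnFrontier

lemma sq_add_sq_add_sq_le (x y z : ℝ) : (x + y + z) ^ 2 ≤ 3 * (x ^ 2 + y ^ 2 + z ^ 2) := by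
  nlinarith [sq_nonneg (x - y), sq_nonneg (y - z), sq_nonneg (x - z)]

lemma quadratic_form_ge {a P Q r s : ℝ} (ha : 0 ≤ a) (hP : a ≤ P) (hQ : a ≤ Q) (hs0 : 0 ≤ s)
    (hs1 : s ≤ 1) (hsr : s ≤ r) (fx fy gx gy : ℝ) :
    (a * s) ^ 2 * (fx ^ 2 + fy ^ 2 + gx ^ 2 + gy ^ 2) ≤
      (r * Q * fx - P * gy) ^ 2 + r * (P * fy + Q * gx) ^ 2 +
        2 * (r * (P * Q)) * (fx * gy - fy * gx) := by
  have hs2 : s ^ 2 ≤ r := by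
    rw [sq]
    exact (mul_le_of_le_one_left hs0 hs1).trans hsr
  have hP0 : 0 ≤ P := ha.trans hP
  have hQ0 : 0 ≤ Q := ha.trans hQ
  have c1 : (a * s) ^ 2 * fx ^ 2 ≤ (Q * r) ^ 2 * fx ^ 2 := by gcongr
  have c2 : (a * s) ^ 2 * gy ^ 2 ≤ (P * 1) ^ 2 * gy ^ 2 := by gcongr
  have c3 : a ^ 2 * s ^ 2 * fy ^ 2 ≤ P ^ 2 * r * fy ^ 2 := by gcongr
  have c4 : a ^ 2 * s ^ 2 * gx ^ 2 ≤ Q ^ 2 * r * gx ^ 2 := by gcongr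
  linarith

namespace Setup2D

variable {S : Setup2D} {p : ℝ × ℝ}

/-- Eliminating `u_t` from the diagonal entries of the simplified gradient. -/
lemma ratio_mul_F22_sub_F33 {r : ℝ} (hP : 0 < S.Ath p) (hQ : 0 < S.Az p)
    (hr : S.kz p = r * S.kth p) :
    r * S.Az p * dTh S.uth p - S.Ath p * dZ S.uz p =
      S.Az p * S.Ath p * (r * S.F22 p - S.F33 p) + -(r * dZ S.Ath p) * S.uz p +
        dTh S.Az p * S.uth p := by
  unfold F22 F33
  rw [hr]
  field_simp
  ring

lemma two_mul_F23sym (hP : 0 < S.Ath p) (hQ : 0 < S.Az p) :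
    S.Ath p * dZ S.uth p + S.Az p * dTh S.uz p =
      S.Az p * S.Ath p * (2 * S.F23sym p) + dTh S.Az p * S.uz p + dZ S.Ath p * S.uth p := by
  unfold F23sym F23 F32
  field_simp
  ring

lemma mul_kth_mul_ut (hP : 0 < S.Ath p) (hQ : 0 < S.Az p) :
    S.Az p * S.Ath p * (S.kth p * S.ut p) =
      S.Az p * S.Ath p * S.F22 p + -S.Az p * dTh S.uth p + -dZ S.Ath p * S.uz p := by
  unfold F22
  field_simp
  ring

lemma FsymSq_nonneg (S : Setup2D) (p : ℝ × ℝ) : 0 ≤ S.FsymSq p := by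
  unfold FsymSq
  positivity

lemma coercive_pointwise {a A B ρ0 ρ1 r s : ℝ} (ha : 0 < a)
    (hP : a ≤ S.Ath p) (hP' : S.Ath p ≤ A) (hQ : a ≤ S.Az p) (hQ' : S.Az p ≤ A)
    (hPz : |dZ S.Ath p| ≤ B) (hQθ : |dTh S.Az p| ≤ B)
    (hρ0 : ρ0 ≤ r) (hρ1 : r ≤ ρ1) (hs0 : 0 < s) (hs1 : s ≤ 1) (hsρ : s ≤ ρ0)
    (hr : S.kz p = r * S.kth p) :
    (a * s) ^ 2 * (dTh S.uth p ^ 2 + dZ S.uth p ^ 2 + dTh S.uz p ^ 2 + dZ S.uz p ^ 2) ≤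
      (1 + ρ1) * (3 * (2 * A ^ 2 * (ρ1 ^ 2 + 1) + ρ1 ^ 2 * B ^ 2 + B ^ 2)) *
        (S.Ath p * S.Az p * S.FsymSq p + S.uth p ^ 2 + S.uz p ^ 2) +
      2 * (r * (S.Ath p * S.Az p)) *
        (dTh S.uth p * dZ S.uz p - dZ S.uth p * dTh S.uz p) := by
  have hP0 : 0 < S.Ath p := ha.trans_le hP
  have hQ0 : 0 < S.Az p := ha.trans_le hQ
  have hr0 : 0 < r := by linarith
  have hA0 : 0 ≤ A := by linarith
  have hρ10 : 0 ≤ ρ1 := by linarith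
  have e1 := S.ratio_mul_F22_sub_F33 hP0 hQ0 hr
  have e2 := S.two_mul_F23sym hP0 hQ0
  have hBz : dZ S.Ath p ^ 2 ≤ B ^ 2 := sq_le_sq' (abs_le.1 hPz).1 (abs_le.1 hPz).2
  have hBθ : dTh S.Az p ^ 2 ≤ B ^ 2 := sq_le_sq' (abs_le.1 hQθ).1 (abs_le.1 hQθ).2
  have hr2 : r ^ 2 ≤ ρ1 ^ 2 := by gcongr
  have hPQ : S.Ath p * S.Az p ≤ A ^ 2 := by
    rw [sq]
    gcongr
  unfold FsymSq
  generalize S.F22 p = x at *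
  generalize S.F33 p = y at *
  generalize S.F23sym p = t at *
  generalize S.Ath p = P at *
  generalize S.Az p = Q at *
  generalize dZ S.Ath p = Pz at *
  generalize dTh S.Az p = Qθ at *
  generalize dTh S.uth p = fx at *
  generalize dZ S.uth p = fy at *
  generalize dTh S.uz p = gx at *
  generalize dZ S.uz p = gy at *
  generalize S.uth p = f at *
  generalize S.uz p = g at *
  set W := P * Q with hW
  have hW0 : 0 < W := mul_pos hP0 hQ0
  set h := W * (x ^ 2 + 2 * t ^ 2 + y ^ 2) with hh
  have hh0 : 0 ≤ h := by positivity
  have hzg : Pz ^ 2 * g ^ 2 ≤ B ^ 2 * g ^ 2 := by gcongr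
  have hzf : Pz ^ 2 * f ^ 2 ≤ B ^ 2 * f ^ 2 := by gcongr
  have hθf : Qθ ^ 2 * f ^ 2 ≤ B ^ 2 * f ^ 2 := by gcongr
  have hθg : Qθ ^ 2 * g ^ 2 ≤ B ^ 2 * g ^ 2 := by gcongr
  set K1 := 3 * (2 * A ^ 2 * (ρ1 ^ 2 + 1) + ρ1 ^ 2 * B ^ 2 + B ^ 2) with hK1
  have hK1h : 6 * A ^ 2 * (ρ1 ^ 2 + 1) * h ≤ K1 * h := by
    have : 0 ≤ (3 * ρ1 ^ 2 * B ^ 2 + 3 * B ^ 2) * h := by positivity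
    rw [hK1]
    linarith only [this]
  have hK1g : (3 * ρ1 ^ 2 * B ^ 2 + 3 * B ^ 2) * g ^ 2 ≤ K1 * g ^ 2 := by
    have : 0 ≤ 6 * A ^ 2 * (ρ1 ^ 2 + 1) * g ^ 2 := by positivity
    rw [hK1]
    linarith only [this]
  have hK1f : 3 * B ^ 2 * f ^ 2 ≤ K1 * f ^ 2 := by
    have : 0 ≤ (6 * A ^ 2 * (ρ1 ^ 2 + 1) + 3 * ρ1 ^ 2 * B ^ 2) * f ^ 2 := by positivity
    rw [hK1]
    linarith only [this]
  clear_value K1 h W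
  have b1 : (r * Q * fx - P * gy) ^ 2 ≤ K1 * (h + f ^ 2 + g ^ 2) := by
    rw [e1]
    refine (sq_add_sq_add_sq_le _ _ _).trans ?_
    have h1 : (r * x - y) ^ 2 ≤ 2 * (ρ1 ^ 2 + 1) * (x ^ 2 + 2 * t ^ 2 + y ^ 2) := by
      have : r ^ 2 * x ^ 2 ≤ ρ1 ^ 2 * x ^ 2 := by gcongr
      nlinarith [sq_nonneg (r * x + y), sq_nonneg (ρ1 * t), sq_nonneg (ρ1 * y), sq_nonneg t,
        sq_nonneg x]
    have h2 : (Q * P * (r * x - y)) ^ 2 ≤ 2 * (ρ1 ^ 2 + 1) * (A ^ 2 * h) := by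
      calc (Q * P * (r * x - y)) ^ 2 = W ^ 2 * (r * x - y) ^ 2 := by rw [hW]; ring
        _ ≤ W ^ 2 * (2 * (ρ1 ^ 2 + 1) * (x ^ 2 + 2 * t ^ 2 + y ^ 2)) := by gcongr
        _ = 2 * (ρ1 ^ 2 + 1) * (W * h) := by rw [hh]; ring
        _ ≤ _ := by gcongr
    have h3 : (-(r * Pz) * g) ^ 2 ≤ ρ1 ^ 2 * (B ^ 2 * g ^ 2) := by
      calc (-(r * Pz) * g) ^ 2 = r ^ 2 * (Pz ^ 2 * g ^ 2) := by ring
        _ ≤ _ := by gcongr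
    linarith only [h2, h3, hθf, hK1h, hK1g, hK1f, mul_nonneg (sq_nonneg B) (sq_nonneg g)]
  have b2 : (P * fy + Q * gx) ^ 2 ≤ K1 * (h + f ^ 2 + g ^ 2) := by
    rw [e2]
    refine (sq_add_sq_add_sq_le _ _ _).trans ?_
    have h2 : (Q * P * (2 * t)) ^ 2 ≤ 2 * (A ^ 2 * h) := by
      calc (Q * P * (2 * t)) ^ 2 = 2 * (W * (W * (2 * t ^ 2))) := by rw [hW]; ring
        _ ≤ 2 * (W * h) := by
          rw [hh]
          gcongr
          linarith [sq_nonneg x, sq_nonneg y]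
        _ ≤ _ := by gcongr
    have h4 : 0 ≤ ρ1 ^ 2 * B ^ 2 * g ^ 2 := by positivity
    have h5 : 0 ≤ ρ1 ^ 2 * (A ^ 2 * h) := by positivity
    have h6 : 0 ≤ A ^ 2 * h := by positivity
    linarith only [h2, h4, h5, h6, hθg, hzf, hK1h, hK1g, hK1f]
  have hb : (r * Q * fx - P * gy) ^ 2 + r * (P * fy + Q * gx) ^ 2 ≤
      (1 + ρ1) * K1 * (h + f ^ 2 + g ^ 2) := by
    have h1 : r * (P * fy + Q * gx) ^ 2 ≤ ρ1 * (K1 * (h + f ^ 2 + g ^ 2)) := by gcongr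
    linarith only [h1, b1]
  have hform := quadratic_form_ge ha.le hP hQ hs0.le hs1 (hsρ.trans hρ0) fx fy gx gy
  rw [← hW] at hform
  linarith only [hform, hb]

lemma ut_sq_le_of_le_sqrt {a A B c μ : ℝ} (ha : 0 < a) (hc : 0 < c) (hμ : 0 < μ)
    (hP : a ≤ S.Ath p) (hQ : a ≤ S.Az p) (hQ' : S.Az p ≤ A) (hPz : |dZ S.Ath p| ≤ B)
    (hk : c⁻¹ * Real.sqrt (S.kth p * S.kz p) ≤ S.kth p)
    (hμk : μ ≤ Real.sqrt (S.kth p * S.kz p)) :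
    S.Ath p * S.Az p * S.ut p ^ 2 ≤
      c ^ 2 * (3 * (1 + A ^ 2 / a ^ 2 + B ^ 2 / a ^ 2)) / μ ^ 2 *
        (S.Ath p * S.Az p * S.FsymSq p +
          (dTh S.uth p ^ 2 + dZ S.uth p ^ 2 + dTh S.uz p ^ 2 + dZ S.uz p ^ 2) +
          (S.uth p ^ 2 + S.uz p ^ 2)) := by
  have hP0 : 0 < S.Ath p := ha.trans_le hP
  have hQ0 : 0 < S.Az p := ha.trans_le hQ
  have hμc : μ ≤ c * S.kth p := hμk.trans ((inv_mul_le_iff₀ hc).1 hk)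
  have e := S.mul_kth_mul_ut hP0 hQ0
  have hBz : dZ S.Ath p ^ 2 ≤ B ^ 2 := sq_le_sq' (abs_le.1 hPz).1 (abs_le.1 hPz).2
  unfold FsymSq
  set W := S.Ath p * S.Az p with hW
  have hW0 : 0 < W := mul_pos hP0 hQ0
  have hWa : a ^ 2 ≤ W := by
    rw [sq, hW]
    gcongr
  set h := W * (S.F22 p ^ 2 + 2 * S.F23sym p ^ 2 + S.F33 p ^ 2) with hh
  have hFh : W * S.F22 p ^ 2 ≤ h := by
    rw [hh]
    gcongr
    linarith [sq_nonneg (S.F23sym p), sq_nonneg (S.F33 p)]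
  have hh0 : 0 ≤ h := by positivity
  have h1 : W * (S.kth p * S.ut p) ^ 2 ≤
      3 * (h + A ^ 2 / a ^ 2 * dTh S.uth p ^ 2 + B ^ 2 / a ^ 2 * S.uz p ^ 2) := by
    have h2 : W ^ 2 * (S.kth p * S.ut p) ^ 2 ≤
        3 * (W * h + A ^ 2 * dTh S.uth p ^ 2 + B ^ 2 * S.uz p ^ 2) := by
      have h3 := sq_add_sq_add_sq_le (S.Az p * S.Ath p * S.F22 p) (-S.Az p * dTh S.uth p)
        (-dZ S.Ath p * S.uz p)
      rw [← e] at h3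
      have h4 : S.Az p ^ 2 * dTh S.uth p ^ 2 ≤ A ^ 2 * dTh S.uth p ^ 2 := by gcongr
      have h5 : dZ S.Ath p ^ 2 * S.uz p ^ 2 ≤ B ^ 2 * S.uz p ^ 2 := by gcongr
      have h6 : W * (W * S.F22 p ^ 2) ≤ W * h := by gcongr
      rw [hW] at h6 ⊢
      linarith
    have h7 : ∀ X : ℝ, X ^ 2 ≤ W * (X ^ 2 / a ^ 2) := fun X => by
      rw [mul_div_assoc', le_div_iff₀ (by positivity), mul_comm]
      gcongr
    have h8 := mul_le_mul_of_nonneg_right (h7 A) (sq_nonneg (dTh S.uth p))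
    have h9 := mul_le_mul_of_nonneg_right (h7 B) (sq_nonneg (S.uz p))
    refine le_of_mul_le_mul_left ?_ hW0
    linarith
  have h10 : μ ^ 2 * (W * S.ut p ^ 2) ≤ c ^ 2 * (W * (S.kth p * S.ut p) ^ 2) := by
    calc μ ^ 2 * (W * S.ut p ^ 2) ≤ (c * S.kth p) ^ 2 * (W * S.ut p ^ 2) := by gcongr
      _ = _ := by ring
  rw [div_mul_eq_mul_div, le_div_iff₀ (by positivity), mul_comm _ (μ ^ 2), mul_assoc (c ^ 2)]
  refine h10.trans (mul_le_mul_of_nonneg_left (h1.trans ?_) (by positivity))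
  have hA0 : 0 ≤ A ^ 2 / a ^ 2 := by positivity
  have hB0 : 0 ≤ B ^ 2 / a ^ 2 := by positivity
  generalize A ^ 2 / a ^ 2 = X at *
  generalize B ^ 2 / a ^ 2 = Y at *
  have t1 : 0 ≤ X * (h + (dZ S.uth p ^ 2 + dTh S.uz p ^ 2 + dZ S.uz p ^ 2) +
    (S.uth p ^ 2 + S.uz p ^ 2)) := by positivity
  have t2 : 0 ≤ Y * (h + (dTh S.uth p ^ 2 + dZ S.uth p ^ 2 + dTh S.uz p ^ 2 + dZ S.uz p ^ 2) +
    S.uth p ^ 2) := by positivity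
  have t3 : 0 ≤ (dTh S.uth p ^ 2 + dZ S.uth p ^ 2 + dTh S.uz p ^ 2 + dZ S.uz p ^ 2) +
    (S.uth p ^ 2 + S.uz p ^ 2) := by positivity
  linarith

lemma isBounded_E (hS : S.Base) : Bornology.IsBounded S.E := by
  refine (Metric.isBounded_Icc ((0, 0) : ℝ × ℝ) (1, 1)).subset fun q hq => ?_
  obtain ⟨h1, h2⟩ := hS.1 q.1 (Ioo_subset_Icc_self hq.1)
  exact ⟨⟨hq.1.1.le, h1.trans hq.2.1.le⟩, ⟨hq.1.2.le, hq.2.2.le.trans h2.2⟩⟩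

lemma continuousOn_FsymSq (hS : S.Base) : ContinuousOn S.FsymSq (closure S.E) := by
  obtain ⟨-, hP, hQ, hkθ, hkz, hpos, ht, hθ, hz⟩ := hS
  have hne : ∀ q ∈ closure S.E, S.Az q * S.Ath q ≠ 0 := fun q hq =>
    (mul_pos (hpos q hq).2 (hpos q hq).1).ne'
  have cP := hP.continuous
  have cQ := hQ.continuous
  have ckθ := hkθ.continuous
  have ckz := hkz.continuous
  have ct := ht.continuous
  have cθ := hθ.continuous
  have cz := hz.continuous
  have cPz := continuous_dZ hP
  have cQθ := continuous_dTh hQ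
  have cθθ := continuous_dTh hθ
  have cθz := continuous_dZ hθ
  have czθ := continuous_dTh hz
  have czz := continuous_dZ hz
  have h22 : ContinuousOn S.F22 (closure S.E) :=
    ContinuousOn.div (Continuous.continuousOn (by fun_prop)) (cQ.mul cP).continuousOn hne
  have h23 : ContinuousOn S.F23 (closure S.E) :=
    ContinuousOn.div (Continuous.continuousOn (by fun_prop)) (cQ.mul cP).continuousOn hne
  have h32 : ContinuousOn S.F32 (closure S.E) :=
    ContinuousOn.div (Continuous.continuousOn (by fun_prop)) (cQ.mul cP).continuousOn hne
  have h33 : ContinuousOn S.F33 (closure S.E) :=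
    ContinuousOn.div (Continuous.continuousOn (by fun_prop)) (cQ.mul cP).continuousOn hne
  have hs : ContinuousOn S.F23sym (closure S.E) := (h23.add h32).div_const 2
  exact ((h22.pow 2).add (continuousOn_const.mul (hs.pow 2))).add (h33.pow 2)

lemma setIntegral_interior_le_nF (hS : S.Base) :
    ∫ q in interior S.E, S.Ath q * S.Az q * S.FsymSq q ≤ S.nF := by
  have hc : ContinuousOn (fun q => S.Ath q * S.Az q * S.FsymSq q) (closure S.E) :=
    ((hS.2.1.continuous.mul hS.2.2.1.continuous).continuousOn).mul (continuousOn_FsymSq hS)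
  refine setIntegral_mono_set (hc.integrableOn_of_isBounded (isBounded_E hS)) ?_
    interior_subset.eventuallyLE
  refine ae_restrict_of_ae_restrict_of_subset subset_closure
    (ae_restrict_of_forall_mem isClosed_closure.measurableSet fun q hq => ?_)
  obtain ⟨h1, h2⟩ := hS.2.2.2.2.2.1 q hq
  exact mul_nonneg (mul_pos h1 h2).le (S.FsymSq_nonneg q)

lemma setIntegral_ut_sq_diff_le (hS : S.Base) (h0 : S.BZero) {D : Set (ℝ × ℝ)}
    (hD : MeasurableSet D) :
    ∫ q in S.E \ D, S.Ath q * S.Az q * S.ut q ^ 2 ≤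
      ∫ q in interior S.E \ D, S.Ath q * S.Az q * S.ut q ^ 2 := by
  obtain ⟨-, hP, hQ, -, -, hpos, ht, -, -⟩ := id hS
  have hc : Continuous fun q => S.Ath q * S.Az q * S.ut q ^ 2 :=
    (hP.continuous.mul hQ.continuous).mul (ht.continuous.pow 2)
  have hm : MeasurableSet (closure S.E \ D) := isClosed_closure.measurableSet.diff hD
  calc _ ≤ ∫ q in closure S.E \ D, S.Ath q * S.Az q * S.ut q ^ 2 := by
        refine setIntegral_mono_set ?_ ?_ (sdiff_subset_sdiff_left subset_closure).eventuallyLE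
        · exact (hc.continuousOn.integrableOn_compact (isBounded_E hS).isCompact_closure).mono_set
            sdiff_subset
        · refine ae_restrict_of_forall_mem hm fun q hq => ?_
          obtain ⟨h1, h2⟩ := hpos q hq.1
          exact mul_nonneg (mul_pos h1 h2).le (sq_nonneg _)
    _ = _ := by
        refine setIntegral_eq_of_subset_of_forall_sdiff_eq_zero hm
          (sdiff_subset_sdiff_left (interior_subset.trans subset_closure)) fun q hq => ?_
        have hq' : q ∈ frontier S.E := ⟨hq.1.1, fun h => hq.2 ⟨h, hq.1.2⟩⟩
        simp [(h0 q hq').1]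

end Setup2D

/-- The squared form of the exterior bound, with constants depending only on the uniform bounds. -/
lemma exterior_bound_normal_sq {a A B c ρ0 ρ1 c2 : ℝ} (ha : 0 < a) (hA : 0 < A) (hB : 0 < B)
    (hc : 0 < c) (hρ0 : 0 < ρ0) (hρ1 : 0 < ρ1) :
    ∃ C0 K : ℝ, 0 < C0 ∧ 0 < K ∧
      ∀ (S : Setup2D) (ρ : ℝ × ℝ → ℝ),
        S.Base → S.Csq → S.BZero → S.Bounds a A B → S.Comparable c → S.RhoHyp ρ ρ0 ρ1 c2 →
        (∀ θ ∈ Ioo (0 : ℝ) 1, S.z2 θ - S.z1 θ ≤ C0) →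
        ∀ D : Set (ℝ × ℝ), MeasurableSet D → ∀ μ : ℝ, 0 < μ →
          (∀ p ∈ S.E \ D, μ ≤ Real.sqrt (S.kth p * S.kz p)) →
          ∫ p in S.E \ D, S.Ath p * S.Az p * S.ut p ^ 2 ≤ K / μ ^ 2 * S.nF := by
  set s := min 1 ρ0 with hs
  have hs0 : 0 < s := lt_min one_pos hρ0
  set k := (a * s) ^ 2 with hk
  have hk0 : 0 < k := by positivity
  set K := (1 + ρ1) * (3 * (2 * A ^ 2 * (ρ1 ^ 2 + 1) + ρ1 ^ 2 * B ^ 2 + B ^ 2)) with hK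
  have hK0 : 0 < K := by positivity
  set M := ρ1 * (A * B + A * B) + A * A * c2 with hM
  set K3 := K + 4 * M ^ 2 / k with hK3
  have hK30 : 0 < K3 := by positivity
  set C0 := min 1 (k / (16 * K3)) with hC0
  have hC00 : 0 < C0 := lt_min one_pos (by positivity)
  set K4 := c ^ 2 * (3 * (1 + A ^ 2 / a ^ 2 + B ^ 2 / a ^ 2)) with hK4
  have hK40 : 0 < K4 := by positivity
  refine ⟨C0, K4 * (1 + 5 * (4 * K / k)), hC00, by positivity, ?_⟩
  intro S ρ hS hS2 h0 hbd hcomp hρ hwidth D hD μ hμ hμk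
  have hUE : interior S.E ⊆ S.E := interior_subset
  have hUc : interior S.E ⊆ closure S.E := hUE.trans subset_closure
  have hb : Bornology.IsBounded (interior S.E) := (Setup2D.isBounded_E hS).subset hUE
  have hfr : frontier (interior S.E) ⊆ frontier S.E := frontier_interior_subset
  obtain ⟨-, hP, hQ, -, -, hpos, ht, hθ, hz⟩ := id hS
  have hm : ContDiff ℝ 1 fun q => ρ q * (S.Ath q * S.Az q) := hρ.1.mul (hP.mul hQ)
  have hcl : closure (interior S.E) ⊆ closure S.E := closure_mono hUE
  have hcH : ContinuousOn (fun q => S.Ath q * S.Az q * S.FsymSq q) (closure (interior S.E)) :=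
    ((hP.continuous.mul hQ.continuous).continuousOn).mul
      ((Setup2D.continuousOn_FsymSq hS).mono hcl)
  have hH := hcH.integrableOn_of_isBounded hb
  have hdP : ∀ q ∈ closure S.E, ‖fderiv ℝ S.Ath q‖ ≤ B := fun q hq => by
    linarith [(hbd q hq).2.2.2.2, norm_nonneg (fderiv ℝ S.Az q)]
  have hdQ : ∀ q ∈ closure S.E, ‖fderiv ℝ S.Az q‖ ≤ B := fun q hq => by
    linarith [(hbd q hq).2.2.2.2, norm_nonneg (fderiv ℝ S.Ath q)]
  have hprod : ∀ q ∈ interior S.E, ∀ P' Q' ρ' : ℝ, |P'| ≤ B → |Q'| ≤ B → |ρ'| ≤ c2 →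
      |ρ q * (S.Ath q * Q' + S.Az q * P') + S.Ath q * S.Az q * ρ'| ≤ M := by
    intro q hq P' Q' ρ' hP' hQ' hρ'
    obtain ⟨b1, b2, b3, b4, -⟩ := hbd q (hUc hq)
    obtain ⟨r1, r2, -⟩ := hρ.2.2 q (hUc hq)
    have p1 : 0 < S.Ath q := ha.trans_le b1
    have p2 : 0 < S.Az q := ha.trans_le b3
    have p3 : 0 < ρ q := hρ0.trans_le r1
    calc _ ≤ |ρ q| * (|S.Ath q| * |Q'| + |S.Az q| * |P'|) + |S.Ath q| * |S.Az q| * |ρ'| := by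
          refine (abs_add_le _ _).trans ?_
          rw [abs_mul, abs_mul, abs_mul (S.Ath q) (S.Az q), ← abs_mul (S.Ath q) Q',
            ← abs_mul (S.Az q) P']
          gcongr
          exact abs_add_le _ _
      _ ≤ M := by
          rw [abs_of_pos p1, abs_of_pos p2, abs_of_pos p3, hM]
          gcongr
  have hd : ∀ {F : ℝ × ℝ → ℝ} {q}, ContDiff ℝ 1 F → DifferentiableAt ℝ F q :=
    fun hF => hF.differentiable (by norm_num) _
  obtain ⟨hG, hL⟩ := gradient_estimate_of_jacobian_coercive isOpen_interior hb hm hθ hS2.2.2.2.2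
    (fun q hq => (h0 q (hfr hq)).2.1) (fun q hq => (h0 q (hfr hq)).2.2) hH (k := k) (K := K)
    (M := M) (l := C0) (z := S.z1) hk0 hK0.le
    (fun q hq => by
      obtain ⟨b1, b2, b3, b4, -⟩ := hbd q (hUc hq)
      obtain ⟨r1, r2, -⟩ := hρ.2.2 q (hUc hq)
      exact Setup2D.coercive_pointwise ha b1 b2 b3 b4
        ((abs_dZ_le _ _).trans (hdP q (hUc hq))) ((abs_dTh_le _ _).trans (hdQ q (hUc hq)))
        r1 r2 hs0 (min_le_left _ _) (min_le_right _ _) (hρ.2.1 q (hUE hq)))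
    (fun q hq => by
      rw [dTh_mul (hd hρ.1) (hd (hP.mul hQ)), dTh_mul (hd hP) (hd hQ)]
      exact hprod q hq _ _ _ ((abs_dTh_le _ _).trans (hdP q (hUc hq)))
        ((abs_dTh_le _ _).trans (hdQ q (hUc hq)))
        ((abs_dTh_le _ _).trans (hρ.2.2 q (hUc hq)).2.2))
    (fun q hq => by
      rw [dZ_mul (hd hρ.1) (hd (hP.mul hQ)), dZ_mul (hd hP) (hd hQ)]
      exact hprod q hq _ _ _ ((abs_dZ_le _ _).trans (hdP q (hUc hq)))
        ((abs_dZ_le _ _).trans (hdQ q (hUc hq)))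
        ((abs_dZ_le _ _).trans (hρ.2.2 q (hUc hq)).2.2))
    (fun q hq => by
      obtain ⟨h1, h2, h3⟩ := hUE hq
      have := hwidth q.1 h1
      rw [abs_le]
      constructor <;> linarith)
    (by
      have h1 : C0 ≤ 1 := min_le_left _ _
      have h2 : C0 * (16 * K3) ≤ k := (le_div_iff₀ (by positivity)).1 (min_le_right _ _)
      have h3 : C0 ^ 2 * K3 ≤ C0 * K3 := by
        gcongr
        nlinarith
      linarith)
  have hcU : ∀ {F : ℝ × ℝ → ℝ}, Continuous F → IntegrableOn F (interior S.E) := fun hF =>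
    hF.continuousOn.integrableOn_of_isBounded hb
  have cθ := hθ.continuous
  have cz := hz.continuous
  have cθθ := continuous_dTh hθ
  have cθz := continuous_dZ hθ
  have czθ := continuous_dTh hz
  have czz := continuous_dZ hz
  have hIG : IntegrableOn (fun q => dTh S.uth q ^ 2 + dZ S.uth q ^ 2 + dTh S.uz q ^ 2 +
    dZ S.uz q ^ 2) (interior S.E) := hcU (by fun_prop)
  have hIL : IntegrableOn (fun q => S.uth q ^ 2 + S.uz q ^ 2) (interior S.E) := hcU (by fun_prop)
  have hIHG : IntegrableOn (fun q => S.Ath q * S.Az q * S.FsymSq q + (dTh S.uth q ^ 2 +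
    dZ S.uth q ^ 2 + dTh S.uz q ^ 2 + dZ S.uz q ^ 2)) (interior S.E) := hH.add hIG
  have hI : IntegrableOn (fun q => K4 / μ ^ 2 * (S.Ath q * S.Az q * S.FsymSq q +
      (dTh S.uth q ^ 2 + dZ S.uth q ^ 2 + dTh S.uz q ^ 2 + dZ S.uz q ^ 2) +
      (S.uth q ^ 2 + S.uz q ^ 2))) (interior S.E) := (hIHG.add hIL).const_mul (K4 / μ ^ 2)
  have hmU : MeasurableSet (interior S.E) := isOpen_interior.measurableSet
  have hut : Continuous fun q => S.Ath q * S.Az q * S.ut q ^ 2 :=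
    (hP.continuous.mul hQ.continuous).mul (ht.continuous.pow 2)
  have hG0 : 0 ≤ ∫ q in interior S.E,
      (dTh S.uth q ^ 2 + dZ S.uth q ^ 2 + dTh S.uz q ^ 2 + dZ S.uz q ^ 2) :=
    integral_nonneg fun q => by positivity
  have hC01 : C0 ^ 2 ≤ 1 := pow_le_one₀ hC00.le (min_le_left _ _)
  calc ∫ q in S.E \ D, S.Ath q * S.Az q * S.ut q ^ 2
      ≤ ∫ q in interior S.E \ D, S.Ath q * S.Az q * S.ut q ^ 2 :=
        Setup2D.setIntegral_ut_sq_diff_le hS h0 hD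
    _ ≤ ∫ q in interior S.E \ D, K4 / μ ^ 2 * (S.Ath q * S.Az q * S.FsymSq q +
          (dTh S.uth q ^ 2 + dZ S.uth q ^ 2 + dTh S.uz q ^ 2 + dZ S.uz q ^ 2) +
          (S.uth q ^ 2 + S.uz q ^ 2)) := by
        refine setIntegral_mono_on ((hcU hut).mono_set sdiff_subset) (hI.mono_set sdiff_subset)
          (hmU.diff hD) fun q hq => ?_
        obtain ⟨b1, -, b3, b4, -⟩ := hbd q (hUc hq.1)
        exact Setup2D.ut_sq_le_of_le_sqrt ha hc hμ b1 b3 b4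
          ((abs_dZ_le _ _).trans (hdP q (hUc hq.1))) (hcomp q (hUE hq.1)).2.2.1
          (hμk q ⟨hUE hq.1, hq.2⟩)
    _ ≤ ∫ q in interior S.E, K4 / μ ^ 2 * (S.Ath q * S.Az q * S.FsymSq q +
          (dTh S.uth q ^ 2 + dZ S.uth q ^ 2 + dTh S.uz q ^ 2 + dZ S.uz q ^ 2) +
          (S.uth q ^ 2 + S.uz q ^ 2)) := by
        refine setIntegral_mono_set hI (ae_restrict_of_forall_mem hmU fun q hq => ?_)
          sdiff_subset.eventuallyLE
        obtain ⟨h1, h2⟩ := hpos q (hUc hq)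
        have := S.FsymSq_nonneg q
        simp only [Pi.zero_apply]
        positivity
    _ ≤ K4 / μ ^ 2 * ((1 + 5 * (4 * K / k)) *
          ∫ q in interior S.E, S.Ath q * S.Az q * S.FsymSq q) := by
        rw [integral_const_mul, integral_add hIHG hIL, integral_add hH hIG]
        have h1 := mul_le_mul_of_nonneg_right hC01 hG0
        gcongr
        linarith
    _ ≤ K4 / μ ^ 2 * ((1 + 5 * (4 * K / k)) * S.nF) := by
        gcongr
        exact Setup2D.setIntegral_interior_le_nF hS
    _ = K4 * (1 + 5 * (4 * K / k)) / μ ^ 2 * S.nF := by ring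

theorem exterior_bound_normal_2d (a A B c ρ0 ρ1 c2 C1 : ℝ)
    (ha : 0 < a) (hA : 0 < A) (hB : 0 < B) (hc : 0 < c)
    (hρ0 : 0 < ρ0) (hρ1 : 0 < ρ1) (hc2 : 0 < c2) (hC1 : 0 < C1) :
    ∃ C0 C : ℝ, 0 < C0 ∧ 0 < C ∧
      ∀ (S : Setup2D) (ρ : ℝ × ℝ → ℝ),
        S.Base → S.Csq → S.BZero → S.Bounds a A B → S.CodazziGauss →
        S.Comparable c → S.RhoHyp ρ ρ0 ρ1 c2 →
        (∀ θ ∈ Ioo (0 : ℝ) 1, S.z2 θ - S.z1 θ ≤ C0) →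
        ∀ D : Set (ℝ × ℝ), MeasurableSet D →
          (∀ μ : ℝ, 0 < μ →
            (∀ p ∈ S.E \ D, μ ≤ Real.sqrt (S.kth p * S.kz p)) →
            Real.sqrt (∫ p in S.E \ D, S.Ath p * S.Az p * S.ut p ^ 2) ≤
              C / μ * Real.sqrt S.nF) ∧
          (∀ α h : ℝ, 0 < α → 0 < h →
            (∀ p ∈ S.E \ D, C1 * h ^ (2 * α) ≤ Real.sqrt (S.kth p * S.kz p)) →
            Real.sqrt (∫ p in S.E \ D, S.Ath p * S.Az p * S.ut p ^ 2) ≤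
              C / C1 * h ^ (-(2 * α)) * Real.sqrt S.nF) := by
  obtain ⟨C0, K, hC0, hK, h⟩ := exterior_bound_normal_sq (c2 := c2) ha hA hB hc hρ0 hρ1
  refine ⟨C0, Real.sqrt K, hC0, Real.sqrt_pos.2 hK, ?_⟩
  intro S ρ hS hS2 hBZ hbd _ hcomp hρ hw D hD
  have main : ∀ μ : ℝ, 0 < μ → (∀ p ∈ S.E \ D, μ ≤ Real.sqrt (S.kth p * S.kz p)) →
      Real.sqrt (∫ p in S.E \ D, S.Ath p * S.Az p * S.ut p ^ 2) ≤
        Real.sqrt K / μ * Real.sqrt S.nF := by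
    intro μ hμ hμk
    refine (Real.sqrt_le_sqrt (h S ρ hS hS2 hBZ hbd hcomp hρ hw D hD μ hμ hμk)).trans_eq ?_
    rw [Real.sqrt_mul (by positivity), Real.sqrt_div hK.le, Real.sqrt_sq hμ.le]
  refine ⟨main, fun α x _ hx hk => ?_⟩
  refine (main (C1 * x ^ (2 * α)) (by positivity) hk).trans_eq ?_
  rw [Real.rpow_neg hx.le, ← div_eq_mul_inv, div_div]
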